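/- arXiv:2604.09667 — 7 statements merged into one kernel-verified Lean document; each statement's English description precedes it below -/
import Mathlib

section
/- Let μ be a probability measure on ℝ and c ∈ ℝ. If the reflection of μ about c stochastically dominates μ, then there exists a probability measure ν on ℝ that is symmetric about c and stochastically dominates μ. -/
open MeasureTheory

/-- `ν` stochastically dominates `μ`: `ν((x,∞)) ≥ μ((x,∞))` for all `x`. -/
def StochDom (μ ν : Measure ℝ) : Prop :=
  ∀ x : ℝ, μ (Set.Ioi x) ≤ ν (Set.Ioi x)

/-- The reflection of a measure `μ` about `c`: pushforward under `x ↦ 2c − x`. -/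
noncomputable def reflect (μ : Measure ℝ) (c : ℝ) : Measure ℝ :=
  μ.map (fun x => 2 * c - x)

/-- `μ` is symmetric about `c` if it equals its reflection about `c`. -/
def SymmAbout (μ : Measure ℝ) (c : ℝ) : Prop :=
  μ = reflect μ c

/-- Reflection about `c` swaps the half-lines `(x, ∞)` and `(-∞, 2c - x)`. -/
lemma reflect_apply_Ioi (μ : Measure ℝ) (c x : ℝ) :
    reflect μ c (Set.Ioi x) = μ (Set.Iio (2 * c - x)) := by
  rw [reflect, Measure.map_apply (by fun_prop) measurableSet_Ioi, Set.preimage_const_sub_Ioi]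

/-- Reflection about `c` swaps the half-lines `(-∞, x]` and `[2c - x, ∞)`. -/
lemma reflect_apply_Iic (μ : Measure ℝ) (c x : ℝ) :
    reflect μ c (Set.Iic x) = μ (Set.Ici (2 * c - x)) := by
  rw [reflect, Measure.map_apply (by fun_prop) measurableSet_Iic, Set.preimage_const_sub_Iic]

lemma reflect_reflect (μ : Measure ℝ) (c : ℝ) : reflect (reflect μ c) c = μ := by
  rw [reflect, reflect, Measure.map_map (by fun_prop) (by fun_prop)]
  convert Measure.map_id
  simp

/-- If the reflection of `μ` dominates `μ`, then upper closed half-lines are at most as heavy as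
their mirror images. -/
lemma StochDom.measure_Ici_le_measure_Iic {μ : Measure ℝ} [IsProbabilityMeasure μ] {c : ℝ}
    (h : StochDom μ (reflect μ c)) (x : ℝ) :
    μ (Set.Ici (2 * c - x)) ≤ μ (Set.Iic x) := by
  have hcont : Filter.Tendsto (fun z => ENNReal.ofReal (ProbabilityTheory.cdf μ z))
      (nhdsWithin x (Set.Ioi x)) (nhds (ENNReal.ofReal (ProbabilityTheory.cdf μ x))) :=
    ENNReal.tendsto_ofReal (((ProbabilityTheory.cdf μ).right_continuous x).mono
      Set.Ioi_subset_Ici_self)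
  rw [← ProbabilityTheory.ofReal_cdf μ x]
  refine ge_of_tendsto hcont ?_
  filter_upwards [self_mem_nhdsWithin] with z hz
  rw [Set.mem_Ioi] at hz
  rw [ProbabilityTheory.ofReal_cdf]
  calc μ (Set.Ici (2 * c - x)) ≤ μ (Set.Ioi (2 * c - z)) :=
        measure_mono (Set.Ici_subset_Ioi.2 (by linarith))
    _ ≤ reflect μ c (Set.Ioi (2 * c - z)) := h _
    _ = μ (Set.Iio z) := by rw [reflect_apply_Ioi, sub_sub_cancel]
    _ ≤ μ (Set.Iic z) := measure_mono Set.Iio_subset_Iic_self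

/-- The part of `μ` to the right of `c`, its mirror image, and an atom at `c`
carrying the remaining mass. -/
noncomputable def symmetrizeRight (μ : Measure ℝ) (c : ℝ) : Measure ℝ :=
  μ.restrict (Set.Ioi c) + reflect (μ.restrict (Set.Ioi c)) c
    + (1 - (μ (Set.Ioi c) + μ (Set.Ioi c))) • Measure.dirac c

lemma symmAbout_symmetrizeRight (μ : Measure ℝ) (c : ℝ) :
    SymmAbout (symmetrizeRight μ c) c := by
  have hm : Measurable fun x : ℝ => 2 * c - x := by fun_prop
  have hdirac : reflect (Measure.dirac c) c = Measure.dirac c := by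
    rw [reflect, Measure.map_dirac' hm]
    congr 1
    ring
  have hadd (α β : Measure ℝ) : reflect (α + β) c = reflect α c + reflect β c :=
    Measure.map_add _ _ hm
  have hsmul (r : ENNReal) (α : Measure ℝ) : reflect (r • α) c = r • reflect α c :=
    Measure.map_smul _ _ _
  rw [SymmAbout, symmetrizeRight, hadd, hadd, hsmul, hdirac, reflect_reflect,
    add_comm (reflect _ c)]

lemma isProbabilityMeasure_symmetrizeRight {μ : Measure ℝ} {c : ℝ}
    (h : μ (Set.Ioi c) + μ (Set.Ioi c) ≤ 1) :
    IsProbabilityMeasure (symmetrizeRight μ c) := by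
  constructor
  have hm : Measurable fun x : ℝ => 2 * c - x := by fun_prop
  simp only [symmetrizeRight, reflect, Measure.add_apply, Measure.smul_apply,
    Measure.map_apply hm MeasurableSet.univ, Set.preimage_univ, Measure.restrict_apply_univ,
    measure_univ, smul_eq_mul, mul_one]
  exact add_tsub_cancel_of_le h

lemma symmetrizeRight_apply_Iic (μ : Measure ℝ) {c x : ℝ} (hx : x < c) :
    symmetrizeRight μ c (Set.Iic x) = μ (Set.Ici (2 * c - x)) := by
  have hdisj : Set.Iic x ∩ Set.Ioi c = ∅ := by
    ext y
    simp only [Set.mem_inter_iff, Set.mem_Iic, Set.mem_Ioi, Set.mem_empty_iff_false, iff_false]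
    intro hy
    linarith [hy.1, hy.2]
  have hsub : Set.Ici (2 * c - x) ∩ Set.Ioi c = Set.Ici (2 * c - x) :=
    Set.inter_eq_left.2 (Set.Ici_subset_Ioi.2 (by linarith))
  simp [symmetrizeRight, reflect_apply_Iic, Measure.restrict_apply, hdisj, hsub, hx]

lemma stochDom_symmetrizeRight {μ : Measure ℝ} [IsProbabilityMeasure μ] {c : ℝ}
    (hmass : μ (Set.Ioi c) + μ (Set.Ioi c) ≤ 1)
    (h : ∀ x, μ (Set.Ici (2 * c - x)) ≤ μ (Set.Iic x)) :
    StochDom μ (symmetrizeRight μ c) := by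
  have := isProbabilityMeasure_symmetrizeRight hmass
  intro x
  rcases lt_or_ge x c with hx | hx
  · rw [← Set.compl_Iic, prob_compl_eq_one_sub measurableSet_Iic,
      prob_compl_eq_one_sub measurableSet_Iic, symmetrizeRight_apply_Iic μ hx]
    exact tsub_le_tsub_left (h x) 1
  · calc μ (Set.Ioi x) = μ.restrict (Set.Ioi c) (Set.Ioi x) := by
          rw [Measure.restrict_apply measurableSet_Ioi,
            Set.inter_eq_left.2 (Set.Ioi_subset_Ioi hx)]
      _ ≤ symmetrizeRight μ c (Set.Ioi x) := by
          rw [symmetrizeRight, add_assoc, Measure.add_apply]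
          exact le_self_add

/-- If the reflection of the probability measure `μ` about `c` stochastically dominates `μ`,
then there exists a probability measure `ν` symmetric about `c` that stochastically
dominates `μ`. -/
theorem exists_symm_dom_of_reflect_dom (μ : Measure ℝ) [IsProbabilityMeasure μ] (c : ℝ)
    (h : StochDom μ (reflect μ c)) :
    ∃ ν : Measure ℝ, IsProbabilityMeasure ν ∧ SymmAbout ν c ∧ StochDom μ ν := by
  have hmass : μ (Set.Ioi c) + μ (Set.Ioi c) ≤ 1 := by
    have hle : μ (Set.Ioi c) ≤ μ (Set.Iic c) :=
      calc μ (Set.Ioi c) ≤ μ (Set.Ici (2 * c - c)) := measure_mono fun y hy => by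
            simp only [Set.mem_Ioi, Set.mem_Ici] at hy ⊢
            linarith
        _ ≤ μ (Set.Iic c) := h.measure_Ici_le_measure_Iic c
    calc μ (Set.Ioi c) + μ (Set.Ioi c) ≤ μ (Set.Iic c) + μ (Set.Ioi c) := by gcongr
      _ = 1 := by
        rw [← Set.compl_Iic, prob_add_prob_compl measurableSet_Iic]
  exact ⟨symmetrizeRight μ c, isProbabilityMeasure_symmetrizeRight hmass,
    symmAbout_symmetrizeRight μ c,
    stochDom_symmetrizeRight hmass h.measure_Ici_le_measure_Iic⟩
end

section
/- Let μ be a probability measure on ℝ and c ≤ c' real numbers. If the reflection of μ about c stochastically dominates μ, then the reflection of μ about c' also stochastically dominates μ. In other words, the set of centers c for which the reflection of μ about c stochastically dominates μ is upward closed. -/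
open MeasureTheory

/-- The set of centers `c` for which the reflection of `μ` about `c` stochastically
dominates `μ` is upward closed. -/
theorem reflect_stochDom_mono_center (μ : Measure ℝ) [IsProbabilityMeasure μ]
    (c c' : ℝ) (hcc' : c ≤ c') (h : StochDom μ (reflect μ c)) :
    StochDom μ (reflect μ c') := by
  intro x
  refine (h x).trans ?_
  have hm (a : ℝ) : Measurable fun x : ℝ => 2 * a - x := by fun_prop
  rw [reflect, reflect, Measure.map_apply (hm c) measurableSet_Ioi,
    Measure.map_apply (hm c') measurableSet_Ioi]
  refine measure_mono fun y hy => ?_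
  simp only [Set.mem_preimage, Set.mem_Ioi] at hy ⊢
  linarith
end

section
/- Let N and Γ be integers with 1 ≤ Γ ≤ N, and let r_1 ≥ r_2 ≥ … ≥ r_{2N} ≥ 0 be real numbers. For every subset A ⊆ {1,…,2N} with |A| = N and complement B = {1,…,2N} \ A, the sum of the Γ largest values r_i over i ∈ A plus the sum of the Γ largest values r_i over i ∈ B is at least Σ_{i=1}^{Γ} r_i + Σ_{i=N+1}^{N+Γ} r_i. Moreover, this lower bound is attained by the partition A = {1,…,N}, B = {N+1,…,2N}. -/
open Finset

/-- The sum of the `Γ` largest values of `r` over the finite set `X`: the maximum of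
`∑_{i ∈ Z} r i` over all subsets `Z ⊆ X` with `|Z| = Γ`. -/
noncomputable def topSum {n : ℕ} (r : Fin n → ℝ) (X : Finset (Fin n)) (Γ : ℕ) : ℝ :=
  if h : (X.powersetCard Γ).Nonempty then
    (X.powersetCard Γ).sup' h fun Z => ∑ i ∈ Z, r i
  else 0

section LowerSegments

variable {α : Type*} [LinearOrder α]

/-- If `s` and `t` have the same cardinality and every initial interval contains at least as many
elements of `s` as of `t`, then an antitone function has a larger sum over `s` than over `t`. -/
theorem sum_le_sum_of_card_filter_le {f : α → ℝ} (hf : Antitone f) (t s : Finset α)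
    (hcard : s.card = t.card)
    (h : ∀ m, (t.filter (· ≤ m)).card ≤ (s.filter (· ≤ m)).card) :
    ∑ i ∈ t, f i ≤ ∑ i ∈ s, f i := by
  induction t using Finset.induction_on_max generalizing s with
  | empty => simp_all
  | insert a t ha ih =>
    have hat : a ∉ t := fun h' => lt_irrefl a (ha a h')
    rw [card_insert_of_notMem hat] at hcard
    have hs : s.Nonempty := card_pos.mp (by omega)
    have hb : s.max' hs ∈ s := s.max'_mem hs
    have hmax : ∀ x ∈ s, x ≤ s.max' hs := fun x hx => s.le_max' x hx
    generalize s.max' hs = b at hb hmax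
    have hba : b ≤ a := by
      have h1 := h a
      rw [filter_true_of_mem (s := insert a t) (by grind), card_insert_of_notMem hat,
        ← hcard] at h1
      have h2 := eq_of_subset_of_card_le (filter_subset (· ≤ a) s) h1
      exact filter_eq_self.mp h2 b hb
    have herase : (s.erase b).card = t.card := by rw [card_erase_of_mem hb]; omega
    rw [sum_insert hat, ← add_sum_erase s f hb]
    refine add_le_add (hf hba) (ih _ herase fun m => ?_)
    rcases le_or_gt b m with hbm | hbm
    · rw [filter_true_of_mem (s := s.erase b) (by grind), herase]
      exact card_filter_le _ _
    · have h1 : (s.erase b).filter (· ≤ m) = s.filter (· ≤ m) := by grind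
      rw [h1]
      exact (card_le_card (filter_subset_filter _ (subset_insert a t))).trans (h m)

/-- A finite set has lower segments of every admissible cardinality. -/
theorem exists_lower_segment_card_eq (X : Finset α) {k : ℕ} (hk : k ≤ X.card) :
    ∃ Z ⊆ X, Z.card = k ∧ ∀ i ∈ Z, ∀ j ∈ X, j ≤ i → j ∈ Z := by
  induction X using Finset.induction_on_max with
  | empty => exact ⟨∅, by simp_all⟩
  | insert a X ha ih =>
    rcases hk.eq_or_lt with rfl | hlt
    · exact ⟨_, Subset.rfl, rfl, fun _ _ j hj _ => hj⟩
    · rw [card_insert_of_notMem fun h' => lt_irrefl a (ha a h')] at hlt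
      obtain ⟨Z, hZX, hZ, hlow⟩ := ih (by omega)
      refine ⟨Z, hZX.trans (subset_insert a X), hZ, fun i hi j hj hji => ?_⟩
      rcases mem_insert.mp hj with rfl | hj
      · exact absurd (ha i (hZX hi)) hji.not_gt
      · exact hlow i hi j hj hji

/-- A lower segment of `X` meets every initial interval in as many elements as possible. -/
theorem min_card_le_card_filter_of_lower {X Z : Finset α}
    (hlow : ∀ i ∈ Z, ∀ j ∈ X, j ≤ i → j ∈ Z) (m : α) :
    min Z.card (X.filter (· ≤ m)).card ≤ (Z.filter (· ≤ m)).card := by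
  by_cases h : ∀ i ∈ Z, i ≤ m
  · rw [filter_true_of_mem h]
    exact min_le_left _ _
  · push Not at h
    obtain ⟨i, hi, hmi⟩ := h
    refine (min_le_right _ _).trans (card_le_card fun j hj => ?_)
    rw [mem_filter] at hj ⊢
    exact ⟨hlow i hi j hj.1 (hj.2.trans hmi.le), hj.2⟩

end LowerSegments

/-- For antitone values, the sum of the largest ones over `X` is the sum over a lower segment. -/
theorem topSum_eq_sum_of_lower {n : ℕ} {r : Fin n → ℝ} (hr : Antitone r) {X Z : Finset (Fin n)}
    {k : ℕ} (hZX : Z ⊆ X) (hZ : Z.card = k) (hlow : ∀ i ∈ Z, ∀ j ∈ X, j ≤ i → j ∈ Z) :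
    topSum r X k = ∑ i ∈ Z, r i := by
  have hmem : Z ∈ X.powersetCard k := mem_powersetCard.mpr ⟨hZX, hZ⟩
  rw [topSum, dif_pos ⟨Z, hmem⟩]
  refine le_antisymm (sup'_le _ _ fun Y hY => ?_) (le_sup' (fun Z => ∑ i ∈ Z, r i) hmem)
  obtain ⟨hYX, hYk⟩ := mem_powersetCard.mp hY
  refine sum_le_sum_of_card_filter_le hr Y Z (hZ.trans hYk.symm) fun m => le_trans ?_
    (min_card_le_card_filter_of_lower hlow m)
  exact le_min ((card_filter_le _ _).trans (by omega))
    (card_le_card (filter_subset_filter _ hYX))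

theorem card_filter_fin_val_mem_Ico {n a b : ℕ} (hb : b ≤ n) :
    (univ.filter fun i : Fin n => a ≤ (i : ℕ) ∧ (i : ℕ) < b).card = b - a := by
  rw [← Nat.card_Ico, ← card_map Fin.valEmbedding]
  congr 1
  ext x
  simp only [mem_map, mem_filter, mem_univ, true_and, Fin.valEmbedding_apply, mem_Ico]
  exact ⟨by rintro ⟨i, hi, rfl⟩; exact hi, fun hx => ⟨⟨x, by omega⟩, hx, rfl⟩⟩

theorem card_filter_fin_val_lt {n b : ℕ} (hb : b ≤ n) :
    (univ.filter fun i : Fin n => (i : ℕ) < b).card = b := by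
  simpa using card_filter_fin_val_mem_Ico (a := 0) hb

/-- Lemma 1: for `r_1 ≥ … ≥ r_{2N} ≥ 0` (0-indexed here) and any `A ⊆ {1,…,2N}` with
`|A| = N` and `B = Aᶜ`, the sum of the `Γ` largest radii on `A` plus that on `B` is at least
`∑_{i=1}^{Γ} r_i + ∑_{i=N+1}^{N+Γ} r_i`, and this bound is attained by
`A = {1,…,N}`, `B = {N+1,…,2N}`. -/
theorem topSum_split_lower_bound (N Γ : ℕ) (hΓ1 : 1 ≤ Γ) (hΓN : Γ ≤ N)
    (r : Fin (2 * N) → ℝ) (hr : Antitone r) (hnn : ∀ i, 0 ≤ r i) :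
    (∀ A : Finset (Fin (2 * N)), A.card = N →
      (∑ i ∈ Finset.univ.filter fun i : Fin (2 * N) => (i : ℕ) < Γ, r i) +
        (∑ i ∈ Finset.univ.filter fun i : Fin (2 * N) => N ≤ (i : ℕ) ∧ (i : ℕ) < N + Γ, r i) ≤
      topSum r A Γ + topSum r Aᶜ Γ) ∧
    topSum r (Finset.univ.filter fun i : Fin (2 * N) => (i : ℕ) < N) Γ +
        topSum r (Finset.univ.filter fun i : Fin (2 * N) => N ≤ (i : ℕ)) Γ =
      (∑ i ∈ Finset.univ.filter fun i : Fin (2 * N) => (i : ℕ) < Γ, r i) +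
        (∑ i ∈ Finset.univ.filter fun i : Fin (2 * N) => N ≤ (i : ℕ) ∧ (i : ℕ) < N + Γ, r i) := by
  have hI : (univ.filter fun i : Fin (2 * N) => (i : ℕ) < Γ).card = Γ :=
    card_filter_fin_val_lt (by omega)
  have hJ : (univ.filter fun i : Fin (2 * N) => N ≤ (i : ℕ) ∧ (i : ℕ) < N + Γ).card = Γ := by
    rw [card_filter_fin_val_mem_Ico (by omega)]
    omega
  refine ⟨fun A hA => ?_, ?_⟩
  · have hB : Aᶜ.card = N := by
      rw [card_compl, Fintype.card_fin]
      omega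
    obtain ⟨Z, hZA, hZ, hZlow⟩ := exists_lower_segment_card_eq A (hΓN.trans hA.ge)
    obtain ⟨W, hWB, hW, hWlow⟩ := exists_lower_segment_card_eq Aᶜ (hΓN.trans hB.ge)
    have hZW : Disjoint Z W := disjoint_compl_right.mono hZA hWB
    have hIJ : Disjoint (univ.filter fun i : Fin (2 * N) => (i : ℕ) < Γ)
        (univ.filter fun i : Fin (2 * N) => N ≤ (i : ℕ) ∧ (i : ℕ) < N + Γ) :=
      disjoint_filter.mpr fun i _ h1 h2 => by omega
    rw [topSum_eq_sum_of_lower hr hZA hZ hZlow, topSum_eq_sum_of_lower hr hWB hW hWlow,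
      ← sum_union hZW, ← sum_union hIJ]
    refine sum_le_sum_of_card_filter_le hr _ _ ?_ fun m => ?_
    · rw [card_union_of_disjoint hZW, card_union_of_disjoint hIJ, hZ, hW, hI, hJ]
    · have hZm := min_card_le_card_filter_of_lower hZlow m
      have hWm := min_card_le_card_filter_of_lower hWlow m
      have hAm : (A.filter (· ≤ m)).card ≤ N := (card_filter_le _ _).trans_eq hA
      have hBm : (Aᶜ.filter (· ≤ m)).card ≤ N := (card_filter_le _ _).trans_eq hB
      have hABm : (A.filter (· ≤ m)).card + (Aᶜ.filter (· ≤ m)).card = m + 1 := by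
        have hfilter : (univ.filter fun i : Fin (2 * N) => (i : ℕ) < m + 1) =
            A.filter (· ≤ m) ∪ Aᶜ.filter (· ≤ m) := by
          ext i
          simp only [mem_filter, mem_univ, true_and, mem_union, mem_compl, Fin.le_def]
          grind
        rw [← card_union_of_disjoint (disjoint_filter_filter (disjoint_compl_right (a := A))),
          ← hfilter, card_filter_fin_val_lt m.isLt]
      have hIm : ((univ.filter fun i : Fin (2 * N) => (i : ℕ) < Γ).filter (· ≤ m)).card ≤
          min Γ (m + 1) := by
        rw [← card_filter_fin_val_lt (n := 2 * N) (b := min Γ (m + 1)) (by omega)]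
        refine card_le_card fun i hi => ?_
        simp only [mem_filter, mem_univ, true_and, Fin.le_def] at hi ⊢
        omega
      have hJm : ((univ.filter fun i : Fin (2 * N) =>
          N ≤ (i : ℕ) ∧ (i : ℕ) < N + Γ).filter (· ≤ m)).card ≤ min (N + Γ) (m + 1) - N := by
        rw [← card_filter_fin_val_mem_Ico (n := 2 * N) (b := min (N + Γ) (m + 1)) (by omega)]
        refine card_le_card fun i hi => ?_
        simp only [mem_filter, mem_univ, true_and, Fin.le_def] at hi ⊢
        omega
      rw [filter_union, filter_union, card_union_of_disjoint (disjoint_filter_filter hZW),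
        card_union_of_disjoint (disjoint_filter_filter hIJ)]
      omega
  · congr 1
    · refine topSum_eq_sum_of_lower hr (fun i hi => ?_) hI fun i hi j hj hji => ?_
      all_goals
        simp only [mem_filter, mem_univ, true_and, Fin.le_def] at *
        omega
    · refine topSum_eq_sum_of_lower hr (fun i hi => ?_) hJ fun i hi j hj hji => ?_
      all_goals
        simp only [mem_filter, mem_univ, true_and, Fin.le_def] at *
        omega
end

section
/- Let n ∈ ℕ and let r_1 ≥ r_2 ≥ … ≥ r_n ≥ 0 be real numbers. Let g : {0,1,…,n} → ℕ be nondecreasing with g(0) = 0. Define subsets S_0, …, S_n of {1,…,n} by S_0 = ∅ and, for 1 ≤ i ≤ n, S_i = S_{i−1} ∪ {i} if g(i) > g(i−1), and S_i = S_{i−1} otherwise. Suppose M_0, …, M_n are subsets of {1,…,n} such that, for every i, M_i ⊆ {1,…,i} and |M_i| ≥ g(i), and for every 0 ≤ i < n either M_{i+1} = M_i or M_{i+1} = M_i ∪ {w} for some w ∈ {1,…,i+1} with w ∉ M_i. Then Σ_{j ∈ M_n} r_j ≥ Σ_{j ∈ S_n} r_j. -/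
open Finset

/-- The greedily constructed certificate sets: `S_0 = ∅`, and `S_{i+1}` adds item `i+1`
(0-indexed: `⟨i, _⟩`) exactly when the lower bound `g` increases at step `i+1`. -/
def certSet (n : ℕ) (g : ℕ → ℕ) : ℕ → Finset (Fin n)
  | 0 => ∅
  | i + 1 =>
    if h : i < n then
      if g i < g (i + 1) then insert (⟨i, h⟩ : Fin n) (certSet n g i) else certSet n g i
    else certSet n g i

theorem certSet_lt {n : ℕ} {g : ℕ → ℕ} {i : ℕ} {j : Fin n} (hj : j ∈ certSet n g i) :
    (j : ℕ) < i := by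
  induction i with
  | zero => simp [certSet] at hj
  | succ i ih =>
    simp only [certSet] at hj
    split_ifs at hj with h h'
    · rcases mem_insert.mp hj with rfl | hj
      · exact Nat.lt_succ_self i
      · exact (ih hj).trans (Nat.lt_succ_self i)
    all_goals exact (ih hj).trans (Nat.lt_succ_self i)

theorem notMem_certSet (n : ℕ) (g : ℕ → ℕ) (i : Fin n) : i ∉ certSet n g i :=
  fun h => lt_irrefl _ (certSet_lt h)

theorem card_certSet_le {n : ℕ} {g : ℕ → ℕ} (hgmono : ∀ i j, i ≤ j → j ≤ n → g i ≤ g j)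
    {i : ℕ} (hi : i ≤ n) : (certSet n g i).card ≤ g i := by
  induction i with
  | zero => simp [certSet]
  | succ i ih =>
    have hle := hgmono i (i + 1) (Nat.le_succ i) hi
    specialize ih (Nat.le_of_succ_le hi)
    simp only [certSet]
    split_ifs with h h'
    · have hi' : (⟨i, h⟩ : Fin n) ∉ certSet n g i := notMem_certSet n g ⟨i, h⟩
      rw [card_insert_of_notMem hi']
      omega
    all_goals omega

/-- The surplus elements of `M m` over `certSet n g m` contribute at least any common lower
bound `c` of the radii of the first `m` items. -/
theorem certSet_sum_add_surplus_le {n : ℕ} {r : Fin n → ℝ} (hr : Antitone r)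
    {g : ℕ → ℕ} (hgmono : ∀ i j, i ≤ j → j ≤ n → g i ≤ g j) {M : ℕ → Finset (Fin n)}
    (hMzero : M 0 = ∅) (hMcard : ∀ i, i ≤ n → g i ≤ (M i).card)
    (hMstep : ∀ i, i < n →
      M (i + 1) = M i ∨
        ∃ w : Fin n, (w : ℕ) < i + 1 ∧ w ∉ M i ∧ M (i + 1) = insert w (M i))
    {m : ℕ} (hm : m ≤ n) {c : ℝ} (hc : ∀ j : Fin n, (j : ℕ) < m → c ≤ r j) :
    ∑ j ∈ certSet n g m, r j + (((M m).card : ℝ) - (certSet n g m).card) * c ≤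
      ∑ j ∈ M m, r j := by
  induction m generalizing c with
  | zero => simp [certSet, hMzero]
  | succ m ih =>
    set k : Fin n := ⟨m, hm⟩ with hk
    have hck : c ≤ r k := hc k (Nat.lt_succ_self m)
    have hprev := ih (Nat.le_of_succ_le hm) (c := r k) fun j hj => hr (Fin.le_def.mpr hj.le)
    have hcard : ((certSet n g (m + 1)).card : ℝ) ≤ (M (m + 1)).card := by
      exact_mod_cast (card_certSet_le hgmono hm).trans (hMcard _ hm)
    have hmul := mul_le_mul_of_nonneg_left hck (sub_nonneg.mpr hcard)
    have hS : ∑ j ∈ certSet n g (m + 1), r j - (certSet n g (m + 1)).card * r k =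
        ∑ j ∈ certSet n g m, r j - (certSet n g m).card * r k := by
      simp only [certSet, dif_pos (Nat.lt_of_succ_le hm)]
      split_ifs
      · rw [sum_insert (notMem_certSet n g k), card_insert_of_notMem (notMem_certSet n g k)]
        push_cast
        ring
      · rfl
    have hM : ∑ j ∈ M m, r j - (M m).card * r k ≤
        ∑ j ∈ M (m + 1), r j - (M (m + 1)).card * r k := by
      rcases hMstep m hm with h | ⟨w, hw, hwM, h⟩
      · rw [h]
      · have hrw : r k ≤ r w := hr (Fin.le_def.mpr (Nat.le_of_lt_succ hw))
        rw [h, sum_insert hwM, card_insert_of_notMem hwM]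
        push_cast
        linarith
    linarith

/-- Abstract core of Theorem 2 (PrefixUB): with items sorted by radius `r` in nonincreasing
order, a nondecreasing lower bound `g` with `g 0 = 0` on `|M_i|`, and sets `M_i ⊆ {1,…,i}`
growing by at most one element per step, the greedily constructed certificate set `S_n`
satisfies `∑_{j ∈ S_n} r j ≤ ∑_{j ∈ M_n} r j`. -/
theorem certSet_sum_le (n : ℕ) (r : Fin n → ℝ) (hr : Antitone r) (hnn : ∀ i, 0 ≤ r i)
    (g : ℕ → ℕ) (hg0 : g 0 = 0) (hgmono : ∀ i j, i ≤ j → j ≤ n → g i ≤ g j)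
    (M : ℕ → Finset (Fin n))
    (hMsub : ∀ i, i ≤ n → ∀ j ∈ M i, (j : ℕ) < i)
    (hMcard : ∀ i, i ≤ n → g i ≤ (M i).card)
    (hMstep : ∀ i, i < n →
      M (i + 1) = M i ∨
        ∃ w : Fin n, (w : ℕ) < i + 1 ∧ w ∉ M i ∧ M (i + 1) = insert w (M i)) :
    ∑ j ∈ certSet n g n, r j ≤ ∑ j ∈ M n, r j := by
  have hMzero : M 0 = ∅ := eq_empty_of_forall_notMem fun j hj =>
    Nat.not_lt_zero _ (hMsub 0 (Nat.zero_le n) j hj)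
  simpa using certSet_sum_add_surplus_le hr hgmono hMzero hMcard hMstep le_rfl
    (c := 0) fun j _ => hnn j
end

section
/- Let r be a real-valued function on an index set. If a finite set V r-dominates a finite set W, and v ∉ V, w ∉ W are indices with r(v) ≥ r(w), then V ∪ {v} r-dominates W ∪ {w}. -/
open Finset

/-- The `k`-th largest value of `r` on the finite set `V` (for `1 ≤ k ≤ |V|`): the entry at
position `|V| − k` of the list of values of `r` on `V` sorted in nondecreasing order. -/
noncomputable def kthLargest {ι : Type*} (r : ι → ℝ) (V : Finset ι) (k : ℕ) : ℝ :=
  ((V.val.map r).sort (· ≤ ·)).getD (V.card - k) 0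

/-- `V` `r`-dominates `W`: `|V| ≥ |W|` and for every `1 ≤ k ≤ |W|`, the `k`-th largest value
of `r` on `V` is at least the `k`-th largest value of `r` on `W`. -/
def RDominates {ι : Type*} (r : ι → ℝ) (V W : Finset ι) : Prop :=
  W.card ≤ V.card ∧ ∀ k : ℕ, 1 ≤ k → k ≤ W.card → kthLargest r W k ≤ kthLargest r V k

theorem le_getD_iff_of_pairwise_le {l : List ℝ} (hl : l.Pairwise (· ≤ ·)) (t : ℝ)
    {i : ℕ} (hi : i < l.length) (d : ℝ) :
    t ≤ l.getD i d ↔ l.length - i ≤ l.countP (fun x => decide (t ≤ x)) := by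
  induction l generalizing i with
  | nil => simp at hi
  | cons a l ih =>
    obtain ⟨ha, hl'⟩ := List.pairwise_cons.1 hl
    have hle := List.countP_le_length (p := fun x => decide (t ≤ x)) (l := l)
    by_cases hta : t ≤ a
    · have hcount : l.countP (fun x => decide (t ≤ x)) = l.length :=
        List.countP_eq_length.2 fun b hb => decide_eq_true (hta.trans (ha b hb))
      cases i with
      | zero => simp [hta, hcount]
      | succ i =>
        have := ih hl' (Nat.lt_of_succ_lt_succ hi)
        simp only [List.getD_cons_succ, this, List.length_cons, List.countP_cons, hta, hcount]
        simp
        omega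
    · cases i with
      | zero =>
        simp only [List.getD_cons_zero, hta, List.length_cons, List.countP_cons]
        simp
        omega
      | succ i =>
        have := ih hl' (Nat.lt_of_succ_lt_succ hi)
        simp only [List.getD_cons_succ, this, List.length_cons, List.countP_cons, hta]
        simp

theorem le_kthLargest_iff {ι : Type*} (r : ι → ℝ) (V : Finset ι) {k : ℕ} (hk : 1 ≤ k)
    (hkV : k ≤ V.card) (t : ℝ) :
    t ≤ kthLargest r V k ↔ k ≤ (V.filter fun i => t ≤ r i).card := by
  have hlen : ((V.val.map r).sort (· ≤ ·)).length = V.card := by simp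
  have hcount : ((V.val.map r).sort (· ≤ ·)).countP (fun x => decide (t ≤ x)) =
      (V.filter fun i => t ≤ r i).card := by
    rw [← Multiset.coe_countP, Multiset.sort_eq, Multiset.countP_map]
    rfl
  rw [kthLargest, le_getD_iff_of_pairwise_le (Multiset.pairwise_sort _ _) t (by omega), hlen,
    hcount, Nat.sub_sub_self hkV]

theorem RDominates.card_filter_le_card_filter {ι : Type*} {r : ι → ℝ} {V W : Finset ι}
    (h : RDominates r V W) (t : ℝ) :
    (W.filter fun i => t ≤ r i).card ≤ (V.filter fun i => t ≤ r i).card := by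
  rcases Nat.eq_zero_or_pos (W.filter fun i => t ≤ r i).card with h0 | hpos
  · omega
  · have hW := card_filter_le W fun i => t ≤ r i
    exact (le_kthLargest_iff r V hpos (hW.trans h.1) t).1
      (((le_kthLargest_iff r W hpos hW t).2 le_rfl).trans (h.2 _ hpos hW))

/-- If `V` `r`-dominates `W`, `v ∉ V`, `w ∉ W`, and `r v ≥ r w`, then `V ∪ {v}`
`r`-dominates `W ∪ {w}`. -/
theorem rDominates_insert {ι : Type*} [DecidableEq ι] (r : ι → ℝ) (V W : Finset ι)
    (hdom : RDominates r V W) (v w : ι) (hv : v ∉ V) (hw : w ∉ W) (hrvw : r w ≤ r v) :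
    RDominates r (insert v V) (insert w W) := by
  have hcard : (insert w W).card ≤ (insert v V).card := by
    rw [card_insert_of_notMem hv, card_insert_of_notMem hw]
    exact Nat.succ_le_succ hdom.1
  refine ⟨hcard, fun k hk hkW => ?_⟩
  have hmem := (le_kthLargest_iff r (insert w W) hk hkW _).1 le_rfl
  rw [le_kthLargest_iff r _ hk (hkW.trans hcard)]
  refine hmem.trans ?_
  generalize kthLargest r (insert w W) k = t
  have hVW := hdom.card_filter_le_card_filter t
  have hvf : v ∉ V.filter fun i => t ≤ r i := fun h => hv (mem_filter.1 h).1
  have hwf : w ∉ W.filter fun i => t ≤ r i := fun h => hw (mem_filter.1 h).1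
  rw [filter_insert, filter_insert]
  by_cases htw : t ≤ r w
  · rw [if_pos htw, if_pos (htw.trans hrvw), card_insert_of_notMem hvf,
      card_insert_of_notMem hwf]
    omega
  · rw [if_neg htw]
    split_ifs
    · rw [card_insert_of_notMem hvf]
      omega
    · exact hVW
end

section
/- Let n, H be positive integers, C > 0 a real number, and uc_1, …, uc_n nonnegative reals. For 0 ≤ m ≤ n let p_m denote the sum of the m smallest values among uc_1, …, uc_n (so p_0 = 0). Suppose f : {1,…,n} → {1,…,H} is an assignment such that Σ_{i : f(i)=h} uc_i ≤ C for every h ∈ {1,…,H}. Let a_1 ≥ a_2 ≥ … ≥ a_H be the occupancy counts |f^{-1}(h)|, h ∈ {1,…,H}, listed in nonincreasing order. Then for every k ∈ {1,…,H}, p_{a_1 + a_2 + … + a_k} ≤ k·C. -/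
open Finset

/-- The sum of the `m` smallest values among `uc_1, …, uc_n` (with multiplicity):
the sum of the first `m` entries of the sorted-in-nondecreasing-order list of values. -/
noncomputable def smallestSum {n : ℕ} (uc : Fin n → ℝ) (m : ℕ) : ℝ :=
  ((((Finset.univ : Finset (Fin n)).val.map uc).sort (· ≤ ·)).take m).sum

/-- In a sorted list, the initial segment has the least sum among sublists of its length. -/
theorem List.Pairwise.sum_take_length_le_of_sublist {l t : List ℝ} (hl : l.Pairwise (· ≤ ·))
    (h : t.Sublist l) : (l.take t.length).sum ≤ t.sum := by
  induction h with
  | slnil => simp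
  | @cons t l a h ih =>
    obtain ⟨hal, hl⟩ := List.pairwise_cons.mp hl
    refine le_trans ?_ (ih hl)
    rcases t with _ | ⟨b, t⟩
    · simp
    · have hlen : t.length < l.length := h.length_le
      rw [List.length_cons, List.take_succ_cons, List.sum_cons, List.sum_take_succ l _ hlen,
        add_comm]
      gcongr
      exact hal _ (List.getElem_mem hlen)
  | @cons_cons t l a h ih =>
    simpa using ih (List.pairwise_cons.mp hl).2

/-- The sum of the smallest `#T` values is at most the sum of the values over `T`. -/
theorem smallestSum_card_le_sum {n : ℕ} (uc : Fin n → ℝ) (T : Finset (Fin n)) :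
    smallestSum uc #T ≤ ∑ i ∈ T, uc i := by
  have hsub : ((T.val.map uc).sort (· ≤ ·)).Sublist
      (((Finset.univ : Finset (Fin n)).val.map uc).sort (· ≤ ·)) := by
    refine List.sublist_of_subperm_of_pairwise ?_ (Multiset.pairwise_sort _ _)
      (Multiset.pairwise_sort _ _)
    rw [← Multiset.coe_le, Multiset.sort_eq, Multiset.sort_eq]
    exact Multiset.map_le_map (Finset.val_le_iff.mpr (Finset.subset_univ T))
  have h := (Multiset.pairwise_sort _ _).sum_take_length_le_of_sublist hsub
  rw [Multiset.length_sort, Multiset.card_map, ← Multiset.sum_coe (Multiset.sort _ _),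
    Multiset.sort_eq] at h
  exact h

/-- Majorization claim underlying Procedure GammaLB: for any feasible assignment `f` of `n`
machines with nonnegative centers `uc` to `H` hosts of capacity `C`, if `a` is the
nonincreasing rearrangement of the host occupancy counts, then for every `1 ≤ k ≤ H` the
sum of the `a_1 + … + a_k` smallest centers is at most `k·C`. -/
theorem smallestSum_top_occupancies_le (n H : ℕ) (hn : 0 < n) (hH : 0 < H)
    (C : ℝ) (hC : 0 < C) (uc : Fin n → ℝ) (hnn : ∀ i, 0 ≤ uc i)
    (f : Fin n → Fin H)
    (hcap : ∀ h : Fin H, (∑ i ∈ Finset.univ.filter fun i => f i = h, uc i) ≤ C)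
    (a : Fin H → ℕ) (σ : Equiv.Perm (Fin H))
    (ha : ∀ h : Fin H, a h = (Finset.univ.filter fun i => f i = σ h).card)
    (hanti : Antitone a) :
    ∀ k : ℕ, 1 ≤ k → k ≤ H →
      smallestSum uc (∑ h ∈ Finset.univ.filter fun h : Fin H => (h : ℕ) < k, a h) ≤
        (k : ℝ) * C := by
  intro k _ hk
  set S := Finset.univ.filter fun h : Fin H => (h : ℕ) < k
  have hS : #S = k := by simp [S, Fin.card_filter_val_lt, hk]
  have hdisj : (S : Set (Fin H)).PairwiseDisjoint
      fun h => Finset.univ.filter fun i => f i = σ h := by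
    intro h _ h' _ hne
    refine Finset.disjoint_filter.mpr fun i _ hi hi' => hne (σ.injective (hi.symm.trans hi'))
  calc smallestSum uc (∑ h ∈ S, a h)
      = smallestSum uc #(S.biUnion fun h => Finset.univ.filter fun i => f i = σ h) := by
        rw [Finset.card_biUnion hdisj, Finset.sum_congr rfl fun h _ => ha h]
    _ ≤ ∑ i ∈ S.biUnion fun h => Finset.univ.filter fun i => f i = σ h, uc i :=
        smallestSum_card_le_sum uc _
    _ = ∑ h ∈ S, ∑ i ∈ Finset.univ.filter fun i => f i = σ h, uc i :=
        Finset.sum_biUnion hdisj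
    _ ≤ #S • C := Finset.sum_le_card_nsmul _ _ _ fun h _ => hcap (σ h)
    _ = k * C := by rw [hS, nsmul_eq_mul]
end

section
/- Let n, H be positive integers, C > 0, and uc_1 ≤ uc_2 ≤ … ≤ uc_n strictly positive reals sorted in nondecreasing order, with prefix sums p_m = Σ_{i≤m} uc_i (p_0 = 0). Define D_0 = 0 and, for 1 ≤ k ≤ H, D_k = min{m ≤ n : p_m ≥ kC} if such m exists and D_k = n otherwise; set d_k = D_k − D_{k−1}. Let Γ̃ : ℕ → ℝ be discretely concave, i.e., Γ̃(k+1) − Γ̃(k) ≤ Γ̃(k) − Γ̃(k−1) for all k ≥ 1. Then for every assignment f : {1,…,n} → {1,…,H} satisfying Σ_{i : f(i)=h} uc_i ≤ C for every h, with a_h = |f^{-1}(h)|, one has Σ_{h=1}^{H} Γ̃(d_h) ≤ Σ_{h=1}^{H} Γ̃(a_h). -/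
open Finset

/-- A supporting-line inequality for discretely concave sequences. -/
theorem le_add_mul_of_discrete_concave (G : ℕ → ℝ)
    (hanti : Antitone fun k => G (k + 1) - G k) (x y : ℕ) :
    G y ≤ G x + (G (x + 1) - G x) * ((y : ℝ) - x) := by
  rcases le_total x y with h | h
  · induction y, h using Nat.le_induction with
    | base => simp
    | succ y hxy ih =>
      have := hanti hxy
      push_cast
      linarith
  · obtain ⟨t, rfl⟩ := Nat.exists_eq_add_of_le h
    clear h
    induction t with
    | zero => simp
    | succ t ih =>
      have h1 : G (y + (t + 1) + 1) - G (y + (t + 1)) ≤ G (y + t + 1) - G (y + t) :=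
        hanti (by omega : y + t ≤ y + (t + 1))
      have h2 := mul_le_mul_of_nonneg_right h1 (Nat.cast_nonneg (α := ℝ) t)
      have h3 : y + (t + 1) = y + t + 1 := rfl
      rw [h3] at h1 h2 ⊢
      push_cast at ih ⊢
      linarith

/-- Majorization inequality for discretely concave sequences; only the majorized sequence has to
be sorted. -/
theorem sum_le_sum_of_discrete_concave_of_majorizes (G : ℕ → ℝ)
    (hanti : Antitone fun k => G (k + 1) - G k) (a d : ℕ → ℕ) (ha : Antitone a) (H : ℕ)
    (hle : ∀ k ≤ H, ∑ i ∈ range k, a i ≤ ∑ i ∈ range k, d i)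
    (heq : ∑ i ∈ range H, a i = ∑ i ∈ range H, d i) :
    ∑ i ∈ range H, G (d i) ≤ ∑ i ∈ range H, G (a i) := by
  have key : ∀ m ≤ H, ∑ i ∈ range m, G (d i) ≤ ∑ i ∈ range m, G (a i) +
      (G (a m + 1) - G (a m)) *
        (((∑ i ∈ range m, d i : ℕ) : ℝ) - ((∑ i ∈ range m, a i : ℕ) : ℝ)) := by
    intro m
    induction m with
    | zero => simp
    | succ m ih =>
      intro hm
      have h1 := ih (by omega)
      have h2 := le_add_mul_of_discrete_concave G hanti (a m) (d m)
      have h3 : G (a m + 1) - G (a m) ≤ G (a (m + 1) + 1) - G (a (m + 1)) :=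
        hanti (ha (Nat.le_succ m))
      have h4 : ((∑ i ∈ range (m + 1), a i : ℕ) : ℝ) ≤ ((∑ i ∈ range (m + 1), d i : ℕ) : ℝ) :=
        Nat.cast_le.2 (hle _ hm)
      have h5 := mul_le_mul_of_nonneg_right h3 (sub_nonneg.2 h4)
      simp only [sum_range_succ, Nat.cast_add] at h5 ⊢
      linarith
  simpa [heq] using key H le_rfl

/-- Among the sets of a given size, the initial segment has the least sum of a monotone
function. -/
theorem sum_initial_le_sum_of_monotone {n : ℕ} (u : Fin n → ℝ) (hu : Monotone u)
    (S : Finset (Fin n)) :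
    ∑ i ∈ univ.filter (fun i : Fin n => (i : ℕ) < S.card), u i ≤ ∑ i ∈ S, u i := by
  have hS : S.card ≤ n := by simpa using S.card_le_univ
  rcases hS.eq_or_lt with h | h
  · have : S = univ := (card_eq_iff_eq_univ S).1 (by simpa using h)
    subst this
    simp
  · set T := univ.filter (fun i : Fin n => (i : ℕ) < S.card) with hT
    have hc : T.card = S.card := by
      rw [hT, Fin.card_filter_val_lt]
      exact min_eq_right hS
    have hcard : (T \ S).card = (S \ T).card := by
      have h1 := card_sdiff_add_card_inter T S
      have h2 := card_sdiff_add_card_inter S T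
      rw [inter_comm] at h2
      omega
    have h1 : ∑ i ∈ T \ S, u i ≤ (T \ S).card • u ⟨S.card, h⟩ :=
      sum_le_card_nsmul _ _ _ fun i hi => hu (by
        simp only [hT, mem_sdiff, mem_filter, mem_univ, true_and] at hi
        exact Fin.le_def.2 hi.1.le)
    have h2 : (S \ T).card • u ⟨S.card, h⟩ ≤ ∑ i ∈ S \ T, u i :=
      card_nsmul_le_sum _ _ _ fun i hi => hu (by
        simp only [hT, mem_sdiff, mem_filter, mem_univ, true_and, not_lt] at hi
        exact Fin.le_def.2 hi.2)
    have h3 := sum_inter_add_sum_sdiff T S u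
    have h4 := sum_inter_add_sum_sdiff S T u
    rw [inter_comm] at h4
    rw [hcard] at h1
    linarith

/-- Every finite family of natural numbers can be rearranged into an initial segment of an
antitone sequence. -/
theorem exists_perm_antitone_extension {H : ℕ} (a : Fin H → ℕ) :
    ∃ (σ : Equiv.Perm (Fin H)) (b : ℕ → ℕ), Antitone b ∧ ∀ i : Fin H, b i = a (σ i) := by
  refine ⟨Tuple.sort (fun i => OrderDual.toDual (a i)),
    fun k => if h : k < H then a (Tuple.sort (fun i => OrderDual.toDual (a i)) ⟨k, h⟩) else 0,
    ?_, fun i => by simp⟩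
  intro i j hij
  by_cases hj : j < H
  · have hi : i < H := hij.trans_lt hj
    simp only [hi, hj, dif_pos]
    exact Tuple.monotone_sort (fun i => OrderDual.toDual (a i))
      (Fin.mk_le_mk.2 hij : (⟨i, hi⟩ : Fin H) ≤ ⟨j, hj⟩)
  · simp [hj]

/-- GammaLB lower bound (Eq. 6): with machines sorted by center in nondecreasing order and
prefix sums `p`, the greedy Next-fit-with-splitting breakpoints `D_k` give occupancy counts
`d_k = D_k − D_{k−1}` such that for every feasible assignment `f` with occupancy counts
`a_h`, and every discretely concave `Γ̃`, one has `∑_h Γ̃(d_h) ≤ ∑_h Γ̃(a_h)`. -/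
theorem gammaLB_le_of_feasible (n H : ℕ) (hn : 0 < n) (hH : 0 < H)
    (C : ℝ) (hC : 0 < C)
    (uc : Fin n → ℝ) (hpos : ∀ i, 0 < uc i) (hmono : Monotone uc)
    (p : ℕ → ℝ)
    (hp : ∀ m : ℕ, p m = ∑ i ∈ Finset.univ.filter fun i : Fin n => (i : ℕ) < m, uc i)
    (D : ℕ → ℕ) (hD0 : D 0 = 0)
    (hDpos : ∀ k, 1 ≤ k → k ≤ H → (∃ m, m ≤ n ∧ (k : ℝ) * C ≤ p m) →
      D k = sInf {m : ℕ | m ≤ n ∧ (k : ℝ) * C ≤ p m})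
    (hDneg : ∀ k, 1 ≤ k → k ≤ H → (¬ ∃ m, m ≤ n ∧ (k : ℝ) * C ≤ p m) → D k = n)
    (G : ℕ → ℝ) (hconc : ∀ k : ℕ, 1 ≤ k → G (k + 1) - G k ≤ G k - G (k - 1))
    (f : Fin n → Fin H)
    (hcap : ∀ h : Fin H, (∑ i ∈ Finset.univ.filter fun i => f i = h, uc i) ≤ C) :
    ∑ k ∈ Finset.Icc 1 H, G (D k - D (k - 1)) ≤
      ∑ h : Fin H, G ((Finset.univ.filter fun i => f i = h).card) := by
  have hp0 : p 0 = 0 := by simp [hp]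
  have hplt : ∀ x y, x < y → y ≤ n → p x < p y := by
    intro x y hxy hy
    rw [hp, hp]
    refine sum_lt_sum_of_subset (i := ⟨x, by omega⟩) ?_ ?_ ?_ (hpos _) fun j _ _ => (hpos j).le
    · intro i
      simp only [mem_filter, mem_univ, true_and]
      omega
    · simpa using hxy
    · simp
  have hD : ∀ k, k ≤ H → (D k = n ∨ (D k ≤ n ∧ (k : ℝ) * C ≤ p (D k))) := by
    intro k hk
    rcases Nat.eq_zero_or_pos k with rfl | hk0
    · simp [hD0, hp0]
    · by_cases h : ∃ m, m ≤ n ∧ (k : ℝ) * C ≤ p m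
      · rw [hDpos k hk0 hk h]
        exact Or.inr (Nat.sInf_mem h)
      · exact Or.inl (hDneg k hk0 hk h)
  have hDn : ∀ k, k ≤ H → D k ≤ n := fun k hk => (hD k hk).elim le_of_eq And.left
  have hle_D : ∀ k ≤ H, ∀ A ≤ n, p A ≤ k * C → A ≤ D k := by
    intro k hk A hA hpA
    rcases hD k hk with h | ⟨-, h⟩
    · exact hA.trans h.ge
    · by_contra! hlt
      exact absurd (hplt _ _ hlt hA) (by linarith)
  have hDstep : ∀ k, k + 1 ≤ H → D k ≤ D (k + 1) := by
    intro k hk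
    rcases hD (k + 1) hk with h | ⟨h1, h2⟩
    · exact (hDn k (by omega)).trans h.ge
    · rcases Nat.eq_zero_or_pos k with rfl | hk0
      · simp [hD0]
      · have h3 : D (k + 1) ≤ n ∧ (k : ℝ) * C ≤ p (D (k + 1)) :=
          ⟨h1, by push_cast at h2; linarith⟩
        rw [hDpos k hk0 (by omega) ⟨_, h3⟩]
        exact Nat.sInf_le h3
  have hsumD : ∀ k ≤ H, ∑ i ∈ range k, (D (i + 1) - D i) = D k := by
    intro k
    induction k with
    | zero => simp [hD0]
    | succ k ih =>
      intro hk
      rw [sum_range_succ, ih (by omega)]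
      have := hDstep k hk
      omega
  have hanti : Antitone fun k => G (k + 1) - G k :=
    antitone_nat_of_succ_le fun k => by simpa using hconc (k + 1) (by omega)
  have hbins : ∀ B : Finset (Fin H),
      p (∑ h ∈ B, (univ.filter fun i => f i = h).card) ≤ B.card * C := by
    intro B
    have hmaps : ∀ i ∈ univ.filter (fun i => f i ∈ B), f i ∈ B := by simp
    have hfib : ∀ h ∈ B, (univ.filter (fun i => f i ∈ B)).filter (fun i => f i = h) =
        univ.filter fun i => f i = h := by
      intro h hh
      ext i
      simp only [mem_filter, mem_univ, true_and, and_iff_right_iff_imp]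
      rintro rfl
      exact hh
    have hcard : ∑ h ∈ B, (univ.filter fun i => f i = h).card =
        (univ.filter (fun i => f i ∈ B)).card := by
      rw [card_eq_sum_card_fiberwise hmaps]
      exact sum_congr rfl fun h hh => by rw [hfib h hh]
    rw [hcard, hp]
    refine (sum_initial_le_sum_of_monotone uc hmono _).trans ?_
    rw [← sum_fiberwise_of_maps_to hmaps, ← nsmul_eq_mul]
    exact sum_le_card_nsmul _ _ _ fun h hh => by rw [hfib h hh]; exact hcap h
  have htotal : ∑ h : Fin H, (univ.filter fun i => f i = h).card = n := by
    have := card_eq_sum_card_fiberwise (s := univ) (t := univ) (f := f) (by simp)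
    simpa using this.symm
  obtain ⟨σ, b, hb, hbσ⟩ :=
    exists_perm_antitone_extension fun h : Fin H => (univ.filter fun i => f i = h).card
  have hb_sum : ∀ k ≤ H, ∃ B : Finset (Fin H), B.card = k ∧
      ∑ i ∈ range k, b i = ∑ h ∈ B, (univ.filter fun i => f i = h).card := by
    intro k hk
    refine ⟨univ.map ((Fin.castLEEmb hk).trans σ.toEmbedding), by simp, ?_⟩
    rw [sum_map, ← Fin.sum_univ_eq_sum_range]
    exact sum_congr rfl fun i _ => hbσ (Fin.castLE hk i)
  have hb_total : ∑ i ∈ range H, b i = n := by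
    rw [← Fin.sum_univ_eq_sum_range, ← htotal,
      ← Equiv.sum_comp σ fun h => (univ.filter fun i => f i = h).card]
    exact sum_congr rfl fun i _ => hbσ i
  have hb_le : ∀ k ≤ H, ∑ i ∈ range k, b i ≤ D k := by
    intro k hk
    obtain ⟨B, hB, hsum⟩ := hb_sum k hk
    refine hle_D k hk _ ?_ ?_
    · rw [← hb_total]
      exact sum_le_sum_of_subset (range_mono hk)
    · rw [hsum, ← hB]
      exact hbins B
  have hmain := sum_le_sum_of_discrete_concave_of_majorizes G hanti b
    (fun i => D (i + 1) - D i) hb H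
    (fun k hk => (hb_le k hk).trans (hsumD k hk).ge)
    (le_antisymm ((hb_le H le_rfl).trans (hsumD H le_rfl).ge)
      (by rw [hsumD H le_rfl, hb_total]; exact hDn H le_rfl))
  calc ∑ k ∈ Finset.Icc 1 H, G (D k - D (k - 1))
      = ∑ i ∈ range H, G (D (i + 1) - D i) := by
        rw [← Finset.Ico_add_one_right_eq_Icc, sum_Ico_eq_sum_range]
        exact sum_congr (by simp) fun i _ => by rw [add_comm 1 i, Nat.add_sub_cancel]
    _ ≤ ∑ i ∈ range H, G (b i) := hmain
    _ = ∑ h : Fin H, G ((univ.filter fun i => f i = h).card) := by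
        rw [← Fin.sum_univ_eq_sum_range (fun i => G (b i)),
          ← Equiv.sum_comp σ fun h => G ((univ.filter fun i => f i = h).card)]
        exact sum_congr rfl fun i _ => by rw [hbσ i]
end
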